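/- arXiv:1506.01119 — 2 statements merged into one kernel-verified Lean document; each statement's English description precedes it below -/
import Mathlib

section
/- In the (2,2,2) scenario, for all nonnegative reals c0, c1, c34 with c0 + c1 + c34 = 1, the mixture c0 • P0 + c1 • P1 + c34 • P34 belongs to Q_2 if and only if c34 ≤ (1 - c1)^(3/2). -/
open Matrix Kronecker ComplexOrder

/-- A (2,m,v) box: a family of conditional probability distributions. -/
def IsBox (m v : ℕ) (p : Fin m → Fin m → Fin v → Fin v → ℝ) : Prop :=
  (∀ x y a b, 0 ≤ p x y a b) ∧ ∀ x y, ∑ a, ∑ b, p x y a b = 1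

/-- A product box: `p x y a b = f x a * g y b` for local response functions `f`, `g`. -/
def IsProductBox (m v : ℕ) (p : Fin m → Fin m → Fin v → Fin v → ℝ) : Prop :=
  ∃ f g : Fin m → Fin v → ℝ,
    (∀ x a, 0 ≤ f x a) ∧ (∀ y b, 0 ≤ g y b) ∧
    (∀ x, ∑ a, f x a = 1) ∧ (∀ y, ∑ b, g y b = 1) ∧
    ∀ x y a b, p x y a b = f x a * g y b

/-- Membership in `Q_d`: the box is realizable by a shared quantum state of local
dimension `d` together with local POVMs. -/
def IsQuantumBox (d m v : ℕ) (p : Fin m → Fin m → Fin v → Fin v → ℝ) : Prop :=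
  ∃ (ρ : Matrix ((Fin d) × (Fin d)) ((Fin d) × (Fin d)) ℂ)
    (A B : Fin m → Fin v → Matrix (Fin d) (Fin d) ℂ),
    ρ.PosSemidef ∧ ρ.trace = 1 ∧
    (∀ x a, (A x a).PosSemidef) ∧ (∀ x, ∑ a, A x a = 1) ∧
    (∀ y b, (B y b).PosSemidef) ∧ (∀ y, ∑ b, B y b = 1) ∧
    ∀ x y a b, (ρ * (A x a ⊗ₖ B y b)).trace = (p x y a b : ℂ)

/-- Membership in `L_N`: the box is realizable using shared classical randomness
of dimension `N`. -/
def IsLocalBox (N m v : ℕ) (p : Fin m → Fin m → Fin v → Fin v → ℝ) : Prop :=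
  ∃ (w : Fin N → ℝ) (f g : Fin N → Fin m → Fin v → ℝ),
    (∀ l, 0 ≤ w l) ∧ (∑ l, w l = 1) ∧
    (∀ l x a, 0 ≤ f l x a) ∧ (∀ l y b, 0 ≤ g l y b) ∧
    (∀ l x, ∑ a, f l x a = 1) ∧ (∀ l y, ∑ b, g l y b = 1) ∧
    ∀ x y a b, p x y a b = ∑ l, w l * f l x a * g l y b

/-- The maximally mixed box `P0`. -/
noncomputable def P0 : Fin 2 → Fin 2 → Fin 2 → Fin 2 → ℝ :=
  fun _x _y _a _b => 1 / 4

/-- The deterministic box `P1`: both parties always output `1`. -/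
def P1 : Fin 2 → Fin 2 → Fin 2 → Fin 2 → ℝ :=
  fun _x _y a b => if a = 1 ∧ b = 1 then 1 else 0

/-- The box `P34`: uniform mixture of the two input-repeating deterministic boxes,
with `a + b ≡ x + y (mod 2)`. -/
noncomputable def P34 : Fin 2 → Fin 2 → Fin 2 → Fin 2 → ℝ :=
  fun x y a b =>
    if (a : ℕ) + (b : ℕ) ≡ (x : ℕ) + (y : ℕ) [MOD 2] then 1 / 2 else 0

/-- The Hermitian qubit operator with real coordinates `w, x, y, z` in the Pauli basis. -/
noncomputable def pauliMatrix (w x y z : ℝ) : Matrix (Fin 2) (Fin 2) ℂ :=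
  !![(w + z : ℂ), x - y * Complex.I; x + y * Complex.I, w - z]

theorem posSemidef_pauliMatrix {w x y z : ℝ} (hw : 0 ≤ w) (h : x ^ 2 + y ^ 2 + z ^ 2 ≤ w ^ 2) :
    (pauliMatrix w x y z).PosSemidef := by
  have hz : |z| ≤ w := abs_le_of_sq_le_sq (by nlinarith [sq_nonneg x, sq_nonneg y]) hw
  obtain ⟨hz₁, hz₂⟩ := abs_le.mp hz
  refine Matrix.PosSemidef.of_dotProduct_mulVec_nonneg ?_ fun v => ?_
  · ext i j
    fin_cases i <;> fin_cases j <;> simp [pauliMatrix, Complex.ext_iff]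
  · rw [Complex.nonneg_iff]
    simp only [pauliMatrix, dotProduct, Matrix.mulVec, Fin.sum_univ_two, Pi.star_apply,
      Matrix.of_apply, Matrix.cons_val', Matrix.cons_val_zero, Matrix.cons_val_one,
      Matrix.cons_val_fin_one]
    generalize v 0 = p
    generalize v 1 = q
    obtain ⟨a, b⟩ := p
    obtain ⟨c, d⟩ := q
    simp
    constructor
    · by_cases hp : w + z = 0
      · obtain rfl : z = -w := by linarith
        have hx : x = 0 := by nlinarith [sq_nonneg x, sq_nonneg y]
        have hy : y = 0 := by nlinarith [sq_nonneg x, sq_nonneg y]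
        subst hx hy
        nlinarith [mul_nonneg hw (sq_nonneg c), mul_nonneg hw (sq_nonneg d)]
      · have hp' : 0 < w + z := lt_of_le_of_ne (by linarith) (Ne.symm hp)
        refine nonneg_of_mul_nonneg_right ?_ hp'
        have h₁ : 0 ≤ (w ^ 2 - x ^ 2 - y ^ 2 - z ^ 2) * (c ^ 2 + d ^ 2) :=
          mul_nonneg (by linarith) (by positivity)
        nlinarith [sq_nonneg ((w + z) * a + x * c + y * d), sq_nonneg ((w + z) * b + x * d - y * c)]
    · ring

theorem bloch_le_of_posSemidef_pauliMatrix {w x y z : ℝ} (h : (pauliMatrix w x y z).PosSemidef) :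
    0 ≤ w ∧ x ^ 2 + y ^ 2 + z ^ 2 ≤ w ^ 2 := by
  have h₀ := (Complex.nonneg_iff.mp (h.diag_nonneg (i := 0))).1
  have h₁ := (Complex.nonneg_iff.mp (h.diag_nonneg (i := 1))).1
  have h₂ := (Complex.nonneg_iff.mp h.det_nonneg).1
  simp [pauliMatrix, Matrix.det_fin_two] at h₀ h₁ h₂
  constructor <;> nlinarith

theorem one_sub_pauliMatrix (w x y z : ℝ) :
    1 - pauliMatrix w x y z = pauliMatrix (1 - w) (-x) (-y) (-z) := by
  ext i j
  fin_cases i <;> fin_cases j <;> simp [pauliMatrix] <;> ring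

theorem Matrix.IsHermitian.exists_eq_pauliMatrix {F : Matrix (Fin 2) (Fin 2) ℂ}
    (hF : F.IsHermitian) : ∃ w x y z : ℝ, F = pauliMatrix w x y z := by
  have h₀ := hF.apply 0 0
  have h₁ := hF.apply 1 1
  have h₂ := hF.apply 0 1
  have hi : ∀ r : ℝ, -r = r → r = 0 := fun r hr => by linarith
  simp [Complex.ext_iff] at h₀ h₁ h₂
  refine ⟨((F 0 0).re + (F 1 1).re) / 2, (F 1 0).re, (F 1 0).im,
    ((F 0 0).re - (F 1 1).re) / 2, ?_⟩
  ext i j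
  fin_cases i <;> fin_cases j <;>
    simp [pauliMatrix, Complex.ext_iff, hi _ h₀, hi _ h₁, ← h₂.1, ← h₂.2]
  all_goals ring

/-- The Bloch coordinates of a two-outcome qubit measurement. -/
theorem exists_bloch_of_effect {B : Fin 2 → Matrix (Fin 2) (Fin 2) ℂ}
    (hB : ∀ b, (B b).PosSemidef) (hsum : ∑ b, B b = 1) :
    ∃ w x y z : ℝ, B 0 = pauliMatrix w x y z ∧ 0 ≤ w ∧ w ≤ 1 ∧
      x ^ 2 + y ^ 2 + z ^ 2 ≤ w ^ 2 ∧ x ^ 2 + y ^ 2 + z ^ 2 ≤ (1 - w) ^ 2 := by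
  obtain ⟨w, x, y, z, h⟩ := (hB 0).isHermitian.exists_eq_pauliMatrix
  have h₁ := hB 1
  rw [Fin.sum_univ_two] at hsum
  rw [← sub_eq_of_eq_add' hsum.symm, h, one_sub_pauliMatrix] at h₁
  obtain ⟨hw, hl⟩ := bloch_le_of_posSemidef_pauliMatrix (h ▸ hB 0)
  obtain ⟨hw', hl'⟩ := bloch_le_of_posSemidef_pauliMatrix h₁
  exact ⟨w, x, y, z, h, hw, by linarith, hl, by linarith [neg_sq x, neg_sq y, neg_sq z]⟩

theorem Matrix.PosSemidef.re_trace_mul_nonneg {ι : Type*} [Fintype ι]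
    {S T : Matrix ι ι ℂ} (hS : S.PosSemidef) (hT : T.PosSemidef) : 0 ≤ (S * T).trace.re := by
  classical
  obtain ⟨R, rfl⟩ : ∃ R : Matrix ι ι ℂ, Rᴴ * R = T := by
    open scoped MatrixOrder in
    obtain ⟨R, hR, -, rfl⟩ :=
      CFC.exists_sqrt_of_isSelfAdjoint_of_quasispectrumRestricts hT.isHermitian
        (QuasispectrumRestricts.nnreal_of_nonneg hT.nonneg)
    exact ⟨R, by rw [← Matrix.star_eq_conjTranspose, hR.star_eq]⟩
  rw [← Matrix.mul_assoc, Matrix.trace_mul_comm, ← Matrix.mul_assoc]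
  exact (Complex.nonneg_iff.mp (hS.mul_mul_conjTranspose_same R).trace_nonneg).1

/-- The second party's operator steered by an effect `A` of the first party, in Bloch
coordinates, lies in the forward light cone. -/
theorem exists_bloch_of_trace {ρ : Matrix (Fin 2 × Fin 2) (Fin 2 × Fin 2) ℂ}
    {A : Matrix (Fin 2) (Fin 2) ℂ} (hρ : ρ.PosSemidef) (hA : A.PosSemidef) :
    ∃ e₁ e₂ e₃ : ℝ, e₁ ^ 2 + e₂ ^ 2 + e₃ ^ 2 ≤ (ρ * (A ⊗ₖ 1)).trace.re ^ 2 ∧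
      ∀ w x y z : ℝ, (ρ * (A ⊗ₖ pauliMatrix w x y z)).trace.re =
        w * (ρ * (A ⊗ₖ 1)).trace.re + x * e₁ + y * e₂ + z * e₃ := by
  set f : ℝ → ℝ → ℝ → ℝ → ℝ := fun w x y z => (ρ * (A ⊗ₖ pauliMatrix w x y z)).trace.re with hf
  have hone : pauliMatrix 1 0 0 0 = 1 := by
    ext i j
    fin_cases i <;> fin_cases j <;> simp [pauliMatrix]
  have hlin : ∀ w x y z : ℝ, f w x y z =
      w * (ρ * (A ⊗ₖ 1)).trace.re + x * f 0 1 0 0 + y * f 0 0 1 0 + z * f 0 0 0 1 := by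
    intro w x y z
    have h : pauliMatrix w x y z = (w : ℂ) • 1 + (x : ℂ) • pauliMatrix 0 1 0 0 +
        (y : ℂ) • pauliMatrix 0 0 1 0 + (z : ℂ) • pauliMatrix 0 0 0 1 := by
      rw [← hone]
      ext i j
      fin_cases i <;> fin_cases j <;> simp [pauliMatrix] <;> ring
    simp only [hf, h, Matrix.kronecker_add, Matrix.kronecker_smul, Matrix.mul_add,
      Matrix.mul_smul, Matrix.trace_add, Matrix.trace_smul, Complex.add_re, smul_eq_mul,
      Complex.re_ofReal_mul]
  have hpos : ∀ w x y z : ℝ, 0 ≤ w → x ^ 2 + y ^ 2 + z ^ 2 ≤ w ^ 2 → 0 ≤ f w x y z :=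
    fun w x y z hw h => hρ.re_trace_mul_nonneg (hA.kronecker (posSemidef_pauliMatrix hw h))
  refine ⟨f 0 1 0 0, f 0 0 1 0, f 0 0 0 1, ?_, hlin⟩
  generalize f 0 1 0 0 = e₁ at *
  generalize f 0 0 1 0 = e₂ at *
  generalize f 0 0 0 1 = e₃ at *
  have hτ := hpos 1 0 0 0 zero_le_one (by norm_num)
  set s := √(e₁ ^ 2 + e₂ ^ 2 + e₃ ^ 2) with hs
  have hs₀ : 0 ≤ s := Real.sqrt_nonneg _
  have hs₂ : s ^ 2 = e₁ ^ 2 + e₂ ^ 2 + e₃ ^ 2 := Real.sq_sqrt (by positivity)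
  have h := hpos s (-e₁) (-e₂) (-e₃) hs₀ (by rw [hs₂]; exact le_of_eq (by ring))
  rw [hlin] at h hτ
  rw [← hs₂]
  refine pow_le_pow_left₀ hs₀ ?_ 2
  rcases hs₀.eq_or_lt with h0 | h0
  · rw [← h0]; linarith
  · nlinarith

/-- An affine image of the unit ball of `ℝ³` in the plane lies in the ellipse cut out by the Gram
matrix of the two linear forms. -/
theorem gram_le_of_bloch {a₁ a₂ a₃ b₁ b₂ b₃ e₁ e₂ e₃ τ P Q : ℝ} (hτ : 0 < τ)
    (he : e₁ ^ 2 + e₂ ^ 2 + e₃ ^ 2 ≤ τ ^ 2)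
    (hP : a₁ * e₁ + a₂ * e₂ + a₃ * e₃ = τ * P) (hQ : b₁ * e₁ + b₂ * e₂ + b₃ * e₃ = τ * Q) :
    (b₁ ^ 2 + b₂ ^ 2 + b₃ ^ 2) * P ^ 2 - 2 * (a₁ * b₁ + a₂ * b₂ + a₃ * b₃) * P * Q +
        (a₁ ^ 2 + a₂ ^ 2 + a₃ ^ 2) * Q ^ 2 ≤
      (a₁ ^ 2 + a₂ ^ 2 + a₃ ^ 2) * (b₁ ^ 2 + b₂ ^ 2 + b₃ ^ 2) -
        (a₁ * b₁ + a₂ * b₂ + a₃ * b₃) ^ 2 := by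
  refine le_of_mul_le_mul_left ?_ (pow_pos hτ 2)
  have hD : 0 ≤ (a₂ * b₃ - a₃ * b₂) ^ 2 + (a₃ * b₁ - a₁ * b₃) ^ 2 + (a₁ * b₂ - a₂ * b₁) ^ 2 := by
    positivity
  have hm := mul_le_mul_of_nonneg_left he hD
  have hdet := sq_nonneg
    (e₁ * (a₂ * b₃ - a₃ * b₂) + e₂ * (a₃ * b₁ - a₁ * b₃) + e₃ * (a₁ * b₂ - a₂ * b₁))
  have key : τ ^ 2 * ((b₁ ^ 2 + b₂ ^ 2 + b₃ ^ 2) * P ^ 2 -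
      2 * (a₁ * b₁ + a₂ * b₂ + a₃ * b₃) * P * Q + (a₁ ^ 2 + a₂ ^ 2 + a₃ ^ 2) * Q ^ 2) =
      (b₁ ^ 2 + b₂ ^ 2 + b₃ ^ 2) * (τ * P) ^ 2 -
      2 * (a₁ * b₁ + a₂ * b₂ + a₃ * b₃) * (τ * P) * (τ * Q) +
      (a₁ ^ 2 + a₂ ^ 2 + a₃ ^ 2) * (τ * Q) ^ 2 := by ring
  rw [key, ← hP, ← hQ]
  linarith

theorem sq_le_of_bloch {a₁ a₂ a₃ e₁ e₂ e₃ τ P : ℝ} (hτ : 0 < τ)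
    (he : e₁ ^ 2 + e₂ ^ 2 + e₃ ^ 2 ≤ τ ^ 2)
    (hP : a₁ * e₁ + a₂ * e₂ + a₃ * e₃ = τ * P) : P ^ 2 ≤ a₁ ^ 2 + a₂ ^ 2 + a₃ ^ 2 := by
  refine le_of_mul_le_mul_left ?_ (pow_pos hτ 2)
  have hm := mul_le_mul_of_nonneg_left he (by positivity : 0 ≤ a₁ ^ 2 + a₂ ^ 2 + a₃ ^ 2)
  rw [← mul_pow, ← hP]
  linarith [sq_nonneg (a₁ * e₂ - a₂ * e₁), sq_nonneg (a₁ * e₃ - a₃ * e₁),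
    sq_nonneg (a₂ * e₃ - a₃ * e₂)]

/-- An ellipse with Gram matrix `!![X, C; C, B]` and center `(u, v)` containing the
trapezoid with vertices `(1, ±κ)` and `(t, ±tκ)`. -/
theorem sq_le_of_trapezoid_in_ellipse {X B C u v κ t : ℝ} (ht₀ : 0 < t) (ht₁ : t < 1)
    (hu₀ : 0 ≤ u) (hu₂ : u ≤ 2)
    (hlow : X + B - v ^ 2 ≤ u ^ 2) (hupp : X + B - v ^ 2 ≤ (2 - u) ^ 2)
    (h₁ : B * (1 - u) ^ 2 - 2 * C * (1 - u) * (κ - v) + X * (κ - v) ^ 2 ≤ X * B - C ^ 2)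
    (h₂ : B * (1 - u) ^ 2 - 2 * C * (1 - u) * (-κ - v) + X * (-κ - v) ^ 2 ≤ X * B - C ^ 2)
    (h₃ : B * (t - u) ^ 2 - 2 * C * (t - u) * (t * κ - v) + X * (t * κ - v) ^ 2 ≤ X * B - C ^ 2)
    (h₄ : B * (t - u) ^ 2 - 2 * C * (t - u) * (-(t * κ) - v) + X * (-(t * κ) - v) ^ 2 ≤
      X * B - C ^ 2) (h₅ : (1 - u) ^ 2 ≤ X) (h₆ : (t - u) ^ 2 ≤ X) :
    κ ^ 2 * (1 + t) ≤ 2 * t := by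
  have hXpos : 0 < X := by
    by_contra! hX
    have hu : 1 - u = 0 := pow_eq_zero_iff two_ne_zero |>.mp (by nlinarith [sq_nonneg (1 - u)])
    have hu' : t - u = 0 := pow_eq_zero_iff two_ne_zero |>.mp (by nlinarith [sq_nonneg (t - u)])
    linarith
  obtain ⟨Y, hY⟩ : ∃ Y, Y = B - v ^ 2 := ⟨_, rfl⟩
  obtain ⟨K, hK⟩ : ∃ K, K = κ ^ 2 := ⟨_, rfl⟩
  obtain ⟨U, hU₀, hU₁, hXY, hUt⟩ : ∃ U : ℝ, 0 ≤ U ∧ U ≤ 1 ∧ X + Y ≤ U ^ 2 ∧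
      (U - t) ^ 2 ≤ (t - u) ^ 2 := by
    rcases le_total u 1 with hu | hu
    · exact ⟨u, hu₀, hu, by linarith, by nlinarith⟩
    · exact ⟨2 - u, by linarith, by linarith, by linarith, by nlinarith⟩
  have e₁ : K * X ≤ (X - (1 - u) ^ 2) * Y := by
    rw [hK, hY]; nlinarith [sq_nonneg (C + (1 - u) * v)]
  have e₂ : t ^ 2 * K * X ≤ (X - (t - u) ^ 2) * Y := by
    rw [hK, hY]; nlinarith [sq_nonneg (C + (t - u) * v)]
  have hK₀ : 0 ≤ K := hK ▸ sq_nonneg κ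
  rw [← hK]
  clear h₁ h₂ h₃ h₄ hlow hupp hK hY
  by_contra! hcon
  have htt : t ^ 2 < t := by nlinarith only [ht₀, ht₁]
  have hKt : t < K := by
    by_contra! h
    linarith [mul_le_mul_of_nonneg_right h (by linarith : 0 ≤ 1 + t)]
  have hY₀ : 0 < Y := by
    by_contra! hY₀
    have : 0 < K * X := mul_pos (by linarith) hXpos
    linarith [mul_nonneg (sub_nonneg.mpr h₅) (neg_nonneg.mpr hY₀)]
  have hYK : K ≤ Y := by
    refine le_of_mul_le_mul_right ?_ hXpos
    linarith [mul_nonneg (sq_nonneg (1 - u)) hY₀.le]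
  have e₃ : t ^ 2 * K * X ≤ (X - (U - t) ^ 2) * Y :=
    e₂.trans (mul_le_mul_of_nonneg_right (by linarith) hY₀.le)
  have htK : 0 ≤ Y - t ^ 2 * K := by
    have : t ^ 2 * K ≤ 1 * K := mul_le_mul_of_nonneg_right (by linarith) hK₀
    linarith
  have e₄ : Y ^ 2 + U ^ 2 * t ^ 2 * K ≤ (2 * U * t - t ^ 2 * (1 - K)) * Y := by
    have := mul_le_mul_of_nonneg_right (show X ≤ U ^ 2 - Y by linarith) htK
    linarith
  have e₅ : K + U ^ 2 * t ^ 2 ≤ 2 * U * t - t ^ 2 * (1 - K) := by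
    refine le_of_mul_le_mul_right ?_ hY₀
    have : 0 ≤ (Y - K) * (Y - U ^ 2 * t ^ 2) := by
      refine mul_nonneg (by linarith) ?_
      have : U ^ 2 * t ^ 2 ≤ 1 * t :=
        mul_le_mul (pow_le_one₀ hU₀ hU₁) htt.le (sq_nonneg t) zero_le_one
      linarith
    linarith
  have hUtt : U * t ≤ t := mul_le_of_le_one_left ht₀.le hU₁
  have e₆ : (1 - t) ^ 2 ≤ (1 - U * t) ^ 2 := pow_le_pow_left₀ (by linarith) (by linarith) 2
  linarith [mul_lt_mul_of_pos_right hcon (sub_pos.mpr ht₁)]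

/-- A qubit realization of a box, from the point of view of the second party: the assemblage of
Bloch vectors steered by the first party. -/
theorem exists_bloch_of_box {c0 c1 c34 : ℝ}
    {ρ : Matrix (Fin 2 × Fin 2) (Fin 2 × Fin 2) ℂ} {A B : Fin 2 → Fin 2 → Matrix (Fin 2) (Fin 2) ℂ}
    (hρ : ρ.PosSemidef) (hA : ∀ x a, (A x a).PosSemidef) (hB : ∀ y, ∑ b, B y b = 1)
    (hp : ∀ x y a b, (ρ * (A x a ⊗ₖ B y b)).trace =
      ((c0 • P0 + c1 • P1 + c34 • P34) x y a b : ℂ))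
    {w x y z w' x' y' z' : ℝ} (hF : B 0 0 = pauliMatrix w x y z)
    (hG : B 1 0 = pauliMatrix w' x' y' z') (i a : Fin 2) :
    ∃ e₁ e₂ e₃ τ : ℝ, e₁ ^ 2 + e₂ ^ 2 + e₃ ^ 2 ≤ τ ^ 2 ∧
      τ = ∑ b, (c0 • P0 + c1 • P1 + c34 • P34) i 0 a b ∧
      w * τ + x * e₁ + y * e₂ + z * e₃ = (c0 • P0 + c1 • P1 + c34 • P34) i 0 a 0 ∧
      w' * τ + x' * e₁ + y' * e₂ + z' * e₃ = (c0 • P0 + c1 • P1 + c34 • P34) i 1 a 0 := by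
  obtain ⟨e₁, e₂, e₃, he, hlin⟩ := exists_bloch_of_trace hρ (hA i a)
  refine ⟨e₁, e₂, e₃, _, he, ?_, ?_, ?_⟩
  · rw [← hB 0, Fin.sum_univ_two, Fin.sum_univ_two, Matrix.kronecker_add, Matrix.mul_add,
      Matrix.trace_add, hp, hp, Complex.add_re, Complex.ofReal_re, Complex.ofReal_re]
  · rw [← hlin, ← hF, hp, Complex.ofReal_re]
  · rw [← hlin, ← hG, hp, Complex.ofReal_re]

theorem correlation_le_of_isQuantumBox {c0 c1 c34 : ℝ} (h1 : 0 < c1) (h1' : c1 < 1)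
    (hsum : c0 + c1 + c34 = 1)
    (h : IsQuantumBox 2 2 2 (c0 • P0 + c1 • P1 + c34 • P34)) : c34 ^ 2 ≤ (1 - c1) ^ 3 := by
  obtain ⟨ρ, A, B, hρ, -, hA, -, hB, hB₁, hp⟩ := h
  obtain ⟨w, x, y, z, hF, hw₀, hw₁, hl, hl'⟩ := exists_bloch_of_effect (hB 0) (hB₁ 0)
  obtain ⟨w', x', y', z', hG, hw₀', hw₁', hm, hm'⟩ := exists_bloch_of_effect (hB 1) (hB₁ 1)
  have hbox := exists_bloch_of_box hρ hA hB₁ hp hF hG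
  obtain ⟨e₁, e₂, e₃, τ, he, hτ, h₁, h₁'⟩ := hbox 0 0
  obtain ⟨f₁, f₂, f₃, τ₂, hf, hτ₂, h₂, h₂'⟩ := hbox 1 0
  obtain ⟨g₁, g₂, g₃, τ₃, hg, hτ₃, h₃, h₃'⟩ := hbox 0 1
  obtain ⟨k₁, k₂, k₃, τ₄, hk, hτ₄, h₄, h₄'⟩ := hbox 1 1
  clear hbox
  simp [P0, P1, P34, Nat.ModEq] at hτ h₁ h₁' hτ₂ h₂ h₂' hτ₃ h₃ h₃' hτ₄ h₄ h₄'
  obtain rfl : c0 = 1 - c1 - c34 := by linarith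
  obtain rfl : τ = (1 - c1) / 2 := by linarith
  obtain rfl : τ₂ = (1 - c1) / 2 := by linarith
  obtain rfl : τ₃ = (1 + c1) / 2 := by linarith
  obtain rfl : τ₄ = (1 + c1) / 2 := by linarith
  clear hτ hτ₂ hτ₃ hτ₄
  have hq : 0 < (1 - c1) / 2 := by linarith
  have hr : 0 < (1 + c1) / 2 := by linarith
  have hne : 1 - c1 ≠ 0 := by linarith
  have hne' : 1 + c1 ≠ 0 := by linarith
  have key := sq_le_of_trapezoid_in_ellipse (t := (1 - c1) / (1 + c1)) (κ := c34 / (1 - c1))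
    (X := (x + x') ^ 2 + (y + y') ^ 2 + (z + z') ^ 2)
    (B := (x - x') ^ 2 + (y - y') ^ 2 + (z - z') ^ 2)
    (C := (x + x') * (x - x') + (y + y') * (y - y') + (z + z') * (z - z'))
    (u := w + w') (v := w - w') (by apply div_pos <;> linarith)
    (by rw [div_lt_one] <;> linarith) (by linarith) (by linarith) (by linarith) (by linarith)
    (gram_le_of_bloch hq he (by linarith) (by field_simp; linarith))
    (gram_le_of_bloch hq hf (by linarith) (by field_simp; linarith))
    (gram_le_of_bloch hr hk (by field_simp; linarith) (by field_simp; linarith))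
    (gram_le_of_bloch hr hg (by field_simp; linarith) (by field_simp; linarith))
    (sq_le_of_bloch hq he (by linarith)) (sq_le_of_bloch hr hg (by field_simp; linarith))
  have e : 1 + (1 - c1) / (1 + c1) = 2 / (1 + c1) := by field_simp; ring
  have hd : 0 < 1 + c1 := by linarith
  rw [e, ← mul_div_assoc, ← mul_div_assoc, div_le_div_iff_of_pos_right hd, div_pow,
    div_mul_eq_mul_div, div_le_iff₀ (by positivity)] at key
  linarith

theorem isQuantumBox_of_correlation_le {c0 c1 c34 : ℝ} (h1 : 0 ≤ c1) (h1' : c1 ≤ 1)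
    (hsum : c0 + c1 + c34 = 1) (h : c34 ^ 2 ≤ (1 - c1) ^ 3) :
    IsQuantumBox 2 2 2 (c0 • P0 + c1 • P1 + c34 • P34) := by
  obtain ⟨g, hg, hg'⟩ : ∃ g : ℝ, c34 = 2 * (1 - c1) * g ∧ g ^ 2 ≤ (1 - c1) / 4 := by
    rcases h1'.eq_or_lt with rfl | hlt
    · exact ⟨0, by nlinarith, by norm_num⟩
    · have : 0 < 1 - c1 := by linarith
      refine ⟨c34 / (2 * (1 - c1)), by field_simp, ?_⟩
      rw [div_pow, div_le_div_iff₀ (by positivity) (by norm_num)]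
      nlinarith
  obtain ⟨α, hα⟩ : ∃ α : ℝ, α ^ 2 = c1 := ⟨√c1, Real.sq_sqrt h1⟩
  obtain ⟨β, hβ⟩ : ∃ β : ℝ, β ^ 2 = 1 - c1 := ⟨√(1 - c1), Real.sq_sqrt (by linarith)⟩
  let V : Matrix (Fin 2 × Fin 2) (Fin 2) ℂ :=
    Matrix.of fun i k => if i.1 = k ∧ i.2 = k then 1 else 0
  have hV : ∀ M : Matrix (Fin 2) (Fin 2) ℂ, V * M * Vᴴ =
      Matrix.of fun i j => if i.1 = i.2 ∧ j.1 = j.2 then M i.1 j.1 else 0 := by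
    intro M
    ext ⟨i, i'⟩ ⟨j, j'⟩
    fin_cases i <;> fin_cases i' <;> fin_cases j <;> fin_cases j' <;>
      simp [V, Matrix.mul_apply]
  let S : Fin 2 → ℝ := ![1, -1]
  let E : Fin 2 → Fin 2 → Matrix (Fin 2) (Fin 2) ℂ := fun x a =>
    pauliMatrix (1 / 2) (S x * S a * β / 2) 0 (-S a * α / 2)
  have hE : ∀ x a, (E x a).PosSemidef := by
    intro x a
    refine posSemidef_pauliMatrix (by norm_num) (le_of_eq ?_)
    fin_cases x <;> fin_cases a <;> simp [S] <;> linarith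
  have hE₁ : ∀ x, ∑ a, E x a = 1 := by
    intro x
    ext i j
    fin_cases x <;> fin_cases i <;> fin_cases j <;>
      simp [E, S, pauliMatrix, Fin.sum_univ_two] <;> ring
  refine ⟨V * pauliMatrix (1 / 2) g 0 (α / 2) * Vᴴ, E, E, ?_, ?_, hE, hE₁, hE, hE₁, ?_⟩
  · exact (posSemidef_pauliMatrix (by norm_num) (by linarith)).mul_mul_conjTranspose_same V
  · rw [hV]
    simp [Matrix.trace, Fintype.sum_prod_type, pauliMatrix]
    ring
  · intro x y a b
    obtain rfl : c0 = 1 - c1 - c34 := by linarith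
    rw [hV, hg]
    have hα' : (α : ℂ) ^ 2 = c1 := by exact_mod_cast hα
    have hβ' : (β : ℂ) ^ 2 = 1 - c1 := by exact_mod_cast hβ
    fin_cases x <;> fin_cases y <;> fin_cases a <;> fin_cases b <;>
      simp [Matrix.trace, Matrix.mul_apply, Fintype.sum_prod_type, pauliMatrix, E, S,
        P0, P1, P34, Nat.ModEq]
    all_goals first
      | linear_combination (-1 / 4) * hα' + (g / 2 : ℂ) * hβ'
      | linear_combination (-1 / 4) * hα' - (g / 2 : ℂ) * hβ'
      | linear_combination (3 / 4) * hα' + (g / 2 : ℂ) * hβ'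
      | linear_combination (3 / 4) * hα' - (g / 2 : ℂ) * hβ'
    

/-- the mixture `c0•P0 + c1•P1 + c34•P34` is achievable with shared
qubits iff `c34 ≤ (1 - c1)^(3/2)`. -/
theorem triangle_0134_qubit_boundary (c0 c1 c34 : ℝ)
    (h0 : 0 ≤ c0) (h1 : 0 ≤ c1) (h34 : 0 ≤ c34) (hsum : c0 + c1 + c34 = 1) :
    IsQuantumBox 2 2 2 (c0 • P0 + c1 • P1 + c34 • P34) ↔
      c34 ≤ (1 - c1) ^ ((3 : ℝ) / 2) := by
  have hc : 0 ≤ 1 - c1 := by linarith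
  have hpow : ((1 - c1) ^ ((3 : ℝ) / 2)) ^ 2 = (1 - c1) ^ 3 := by
    rw [← Real.rpow_natCast, ← Real.rpow_mul hc, ← Real.rpow_natCast]
    norm_num
  rw [← sq_le_sq₀ h34 (Real.rpow_nonneg hc _), hpow]
  refine ⟨fun h => ?_, isQuantumBox_of_correlation_le h1 (by linarith) hsum⟩
  rcases h1.eq_or_lt with rfl | hpos
  · nlinarith
  rcases (sub_nonneg.mp hc).eq_or_lt with rfl | hlt
  · obtain rfl : c34 = 0 := by linarith
    norm_num
  · exact correlation_le_of_isQuantumBox hpos hlt hsum h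
end

section
/- In the (2,2,2) scenario: if every quantum box is a mixture of qubit-achievable boxes, i.e. Q_d ⊆ convexHull ℝ (Q_2) for every d ≥ 1 (Masanes' theorem), then Q_16 = convexHull ℝ (Q_2); in particular the set Q_16 of (2,2,2) boxes realizable with local quantum dimension 16 is convex. -/
open Matrix Kronecker ComplexOrder

open Set

section FenchelBunt

variable {E : Type*} [NormedAddCommGroup E] [NormedSpace ℝ E] [FiniteDimensional ℝ E]

/-- A preconnected set containing two distinct vertices of a simplex contains a point at which
two different barycentric coordinates, rescaled by positive weights, are simultaneously maximal. -/
theorem IsPreconnected.exists_two_maximal_coord {ι : Type*} [Fintype ι] [Nontrivial ι]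
    {S : Set E} (hS : IsPreconnected S) (b : AffineBasis ι ℝ E) (hb : range b ⊆ S)
    {w : ι → ℝ} (hw : ∀ i, 0 < w i) :
    ∃ s ∈ S, ∃ i j, i ≠ j ∧ b.coord i s / w i = b.coord j s / w j ∧
      ∀ k, b.coord k s / w k ≤ b.coord i s / w i := by
  classical
  obtain ⟨i, j, hij⟩ := exists_pair_ne ι
  have hne : (Finset.univ.erase i).Nonempty := ⟨j, by simp [hij.symm]⟩
  let r : ι → E → ℝ := fun k s => b.coord k s / w k
  have hr : ∀ k, Continuous (r k) := fun k => (continuous_barycentric_coord b k).div_const _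
  have hM : Continuous fun s => (Finset.univ.erase i).sup' hne fun k => r k s :=
    Continuous.finset_sup'_apply hne fun k _ => hr k
  have hi : (Finset.univ.erase i).sup' hne (fun k => r k (b i)) ≤ r i (b i) := by
    refine Finset.sup'_le _ _ fun k hk => ?_
    simp only [r]
    rw [b.coord_apply_ne (Finset.ne_of_mem_erase hk), b.coord_apply_eq]
    simpa using (hw i).le
  have hj : r i (b j) ≤ (Finset.univ.erase i).sup' hne (fun k => r k (b j)) := by
    refine le_trans ?_ (Finset.le_sup' (fun k => r k (b j))
      (Finset.mem_erase.2 ⟨hij.symm, Finset.mem_univ j⟩))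
    simp only [r]
    rw [b.coord_apply_ne hij, b.coord_apply_eq]
    simpa using (hw j).le
  obtain ⟨s, hs, hs_eq⟩ := hS.intermediate_value₂ (hb ⟨i, rfl⟩) (hb ⟨j, rfl⟩)
    hM.continuousOn (hr i).continuousOn hi hj
  obtain ⟨k, hk, hk_eq⟩ := Finset.exists_mem_eq_sup' hne fun k => r k s
  refine ⟨s, hs, i, k, (Finset.ne_of_mem_erase hk).symm, hs_eq.symm.trans hk_eq, fun l => ?_⟩
  rcases eq_or_ne l i with rfl | hl
  · exact le_rfl
  · exact (Finset.le_sup' (fun k => r k s)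
      (Finset.mem_erase.2 ⟨hl, Finset.mem_univ l⟩)).trans hs_eq.le

/-- A point interior to a simplex with vertices in a preconnected set `S` of an `n`-dimensional
space is a convex combination of `n` points of `S`. -/
theorem IsPreconnected.exists_finset_card_le_of_affineBasis {ι : Type*} [Fintype ι] [Nontrivial ι]
    {S : Set E} (hS : IsPreconnected S) (b : AffineBasis ι ℝ E) (hb : range b ⊆ S)
    {w : ι → ℝ} (hw : ∀ i, 0 < w i) (hw1 : ∑ i, w i = 1) :
    ∃ t : Finset E, ↑t ⊆ S ∧ t.card + 1 ≤ Fintype.card ι ∧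
      ∑ i, w i • b i ∈ convexHull ℝ (t : Set E) := by
  classical
  obtain ⟨s, hs, i, j, hij, hr, hmax⟩ := hS.exists_two_maximal_coord b hb hw
  set M := b.coord i s / w i with hM
  have hc : ∀ k, b.coord k s ≤ M * w k := fun k => (div_le_iff₀ (hw k)).1 (hmax k)
  have hM1 : 1 ≤ M := by
    have := Finset.sum_le_sum fun k (_ : k ∈ Finset.univ) => hc k
    rwa [b.sum_coord_apply_eq_one, ← Finset.mul_sum, hw1, mul_one] at this
  have hM0 : 0 < M := one_pos.trans_le hM1
  have hci : M * w i - b.coord i s = 0 := by rw [hM, div_mul_cancel₀ _ (hw i).ne', sub_self]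
  have hcj : M * w j - b.coord j s = 0 := by rw [hr, div_mul_cancel₀ _ (hw j).ne', sub_self]
  let T : Finset ι := (Finset.univ.erase i).erase j
  have hT : ∀ k, k ∉ T → k = i ∨ k = j := by
    intro k hk
    simp only [T, Finset.mem_erase, Finset.mem_univ, and_true] at hk
    tauto
  refine ⟨insert s (T.image b), ?_, ?_, ?_⟩
  · intro x hx
    simp only [Finset.coe_insert, Finset.coe_image, mem_insert_iff, mem_image] at hx
    rcases hx with rfl | ⟨k, -, rfl⟩
    exacts [hs, hb ⟨k, rfl⟩]
  · have h1 : (insert s (T.image b)).card ≤ T.card + 1 :=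
      (Finset.card_insert_le _ _).trans (Nat.add_le_add_right Finset.card_image_le 1)
    have h2 : T.card + 1 = (Finset.univ.erase i).card :=
      Finset.card_erase_add_one (by simp [hij.symm])
    have h3 : (Finset.univ.erase i).card + 1 = Fintype.card ι :=
      Finset.card_erase_add_one (Finset.mem_univ i)
    omega
  · have hsum : ∑ i, w i • b i
        = M⁻¹ • s + ∑ k ∈ T, (M⁻¹ * (M * w k - b.coord k s)) • b k := by
      rw [Finset.sum_subset (Finset.subset_univ T) fun k _ hk => by
        rcases hT k hk with rfl | rfl <;> simp [hci, hcj]]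
      conv_rhs => rw [← b.linear_combination_coord_eq_self s, Finset.smul_sum]
      rw [← Finset.sum_add_distrib]
      refine Finset.sum_congr rfl fun k _ => ?_
      rw [b.linear_combination_coord_eq_self s, smul_smul, ← add_smul]
      congr 1
      field_simp
      ring
    have hone : M⁻¹ + ∑ k ∈ T, M⁻¹ * (M * w k - b.coord k s) = 1 := by
      rw [Finset.sum_subset (Finset.subset_univ T) fun k _ hk => by
        rcases hT k hk with rfl | rfl <;> simp [hci, hcj]]
      rw [← Finset.mul_sum, Finset.sum_sub_distrib, ← Finset.mul_sum, hw1,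
        b.sum_coord_apply_eq_one]
      field_simp
      ring
    have key := (convex_convexHull ℝ ((insert s (T.image b) : Finset E) : Set E)).sum_mem
      (t := Finset.insertNone T)
      (w := fun o => o.elim M⁻¹ fun k => M⁻¹ * (M * w k - b.coord k s))
      (z := fun o => o.elim s b) ?_ ?_ ?_
    · rw [hsum]
      simpa [Finset.sum_insertNone] using key
    · rintro (_ | k) -
      · exact inv_nonneg.2 hM0.le
      · exact mul_nonneg (inv_nonneg.2 hM0.le) (sub_nonneg.2 (hc k))
    · simpa [Finset.sum_insertNone] using hone
    · rintro (_ | k) hk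
      · exact subset_convexHull _ _ (by simp)
      · refine subset_convexHull _ _ ?_
        have hk : k ∈ T := by simpa using hk
        simp only [Finset.coe_insert, Finset.coe_image]
        exact Or.inr ⟨k, hk, rfl⟩

/-- **Fenchel–Bunt theorem**: a point of the convex hull of a preconnected subset `S` of a space
of dimension `n ≥ 1` is a convex combination of `n` points of `S`. -/
theorem IsPreconnected.exists_finset_card_le_finrank {S : Set E} (hS : IsPreconnected S)
    (hE : 0 < Module.finrank ℝ E) {x : E} (hx : x ∈ convexHull ℝ S) :
    ∃ t : Finset E, ↑t ⊆ S ∧ t.card ≤ Module.finrank ℝ E ∧ x ∈ convexHull ℝ (t : Set E) := by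
  classical
  obtain ⟨ι, _, z, w, hz, hind, hw, hw1, rfl⟩ := eq_pos_convex_span_of_mem_convexHull hx
  by_cases hcard : Fintype.card ι ≤ Module.finrank ℝ E
  · refine ⟨Finset.univ.image z, by simpa using hz, Finset.card_image_le.trans hcard, ?_⟩
    exact (convex_convexHull ℝ _).sum_mem (fun i _ => (hw i).le) hw1
      fun i _ => subset_convexHull _ _ (by simp)
  · have hle : Fintype.card ι ≤ Module.finrank ℝ E + 1 :=
      hind.card_le_finrank_succ.trans (Nat.add_le_add_right (Submodule.finrank_le _) 1)
    have heq : Fintype.card ι = Module.finrank ℝ E + 1 := by omega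
    have : Nontrivial ι := Fintype.one_lt_card_iff_nontrivial.1 (by omega)
    obtain ⟨t, ht, htc, hxt⟩ := hS.exists_finset_card_le_of_affineBasis
      ⟨z, hind, hind.affineSpan_eq_top_iff_card_eq_finrank_add_one.2 heq⟩ hz hw hw1
    exact ⟨t, ht, by omega, hxt⟩

end FenchelBunt

/-- The convex hull of the range of a finite family consists of its convex combinations. -/
theorem exists_stdSimplex_of_mem_convexHull_range {ι V : Type*} [Fintype ι] [AddCommGroup V]
    [Module ℝ V] {z : ι → V} {x : V} (hx : x ∈ convexHull ℝ (range z)) :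
    ∃ w ∈ stdSimplex ℝ ι, ∑ i, w i • z i = x := by
  classical
  have hconv : Convex ℝ ((Fintype.linearCombination ℝ z) '' stdSimplex ℝ ι) :=
    (convex_stdSimplex ℝ ι).linear_image _
  refine convexHull_min ?_ hconv hx
  rintro _ ⟨i, rfl⟩
  exact ⟨Pi.single i 1, single_mem_stdSimplex ℝ i, by simp⟩

/-- A nonempty finite set of at most `n` elements is the range of a family indexed by `Fin n`. -/
theorem exists_fin_range_eq_finset {α : Type*} {n : ℕ} (t : Finset α) (ht : t.Nonempty)
    (hn : t.card ≤ n) : ∃ g : Fin n → α, Set.range g = t := by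
  have : Nonempty t := ht.to_subtype
  obtain ⟨f⟩ : Nonempty (t ↪ Fin n) := Function.Embedding.nonempty_of_card_le (by simpa using hn)
  refine ⟨fun i => (Function.invFun f i : t), ?_⟩
  rw [range_comp' Subtype.val, (Function.invFun_surjective f.injective).range_eq]
  simp

section QuantumBox

/-- The diagonal blocks of `Fin n × Fin d ≃ Fin D`, as isometric embeddings. -/
def blockEmbedding {n d D : ℕ} (e : Fin n × Fin d ≃ Fin D) (i : Fin n) :
    Matrix (Fin D) (Fin d) ℂ :=
  (1 : Matrix (Fin D) (Fin D) ℂ).submatrix id fun s => e (i, s)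

theorem conjTranspose_blockEmbedding_mul {n d D : ℕ} (e : Fin n × Fin d ≃ Fin D) (i j : Fin n) :
    (blockEmbedding e i)ᴴ * blockEmbedding e j = if i = j then 1 else 0 := by
  ext s t
  by_cases h : i = j <;>
  simp [blockEmbedding, Matrix.mul_apply, Matrix.one_apply, h]

theorem sum_blockEmbedding_mul_conjTranspose {n d D : ℕ} (e : Fin n × Fin d ≃ Fin D) :
    ∑ i, blockEmbedding e i * (blockEmbedding e i)ᴴ = 1 := by
  ext k l
  obtain ⟨⟨i, s⟩, rfl⟩ := e.surjective k
  obtain ⟨⟨j, t⟩, rfl⟩ := e.surjective l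
  simp only [Matrix.sum_apply, Matrix.mul_apply, ← Fintype.sum_prod_type']
  rw [Fintype.sum_eq_single (i, s)]
  · simp [blockEmbedding, Matrix.one_apply, eq_comm]
  · rintro ⟨i', s'⟩ h
    simp [blockEmbedding, Matrix.one_apply, h.symm]

/-- The compression of a block-diagonal matrix to one of its blocks. -/
theorem compress_sum_blockEmbedding {n d D : ℕ} (e : Fin n × Fin d ≃ Fin D)
    (A : Fin n → Matrix (Fin d) (Fin d) ℂ) (j : Fin n) :
    (blockEmbedding e j)ᴴ * (∑ i, blockEmbedding e i * A i * (blockEmbedding e i)ᴴ) *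
      blockEmbedding e j = A j := by
  rw [Matrix.mul_sum, Matrix.sum_mul, Finset.sum_eq_single j]
  · calc _ = ((blockEmbedding e j)ᴴ * blockEmbedding e j) * A j *
          ((blockEmbedding e j)ᴴ * blockEmbedding e j) := by simp only [Matrix.mul_assoc]
      _ = A j := by simp [conjTranspose_blockEmbedding_mul]
  · intro i _ hi
    calc _ = ((blockEmbedding e j)ᴴ * blockEmbedding e i) * A i *
          ((blockEmbedding e i)ᴴ * blockEmbedding e j) := by simp only [Matrix.mul_assoc]
      _ = 0 := by simp [conjTranspose_blockEmbedding_mul, hi]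
  · simp

/-- A mixture of `n` boxes of local dimension `d` is realizable in local dimension `n * d`. -/
theorem IsQuantumBox.sum_smul {n d D m v : ℕ} (e : Fin n × Fin d ≃ Fin D)
    {p : Fin n → Fin m → Fin m → Fin v → Fin v → ℝ} (hp : ∀ i, IsQuantumBox d m v (p i))
    {w : Fin n → ℝ} (hw : w ∈ stdSimplex ℝ (Fin n)) :
    IsQuantumBox D m v (∑ i, w i • p i) := by
  choose ρ A B hρ hρ1 hA hA1 hB hB1 hp using hp
  set W := blockEmbedding e
  have hW : ∀ i, (W i)ᴴ * W i = 1 := fun i => by simp [W, conjTranspose_blockEmbedding_mul]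
  have hsum : ∀ C : Fin n → Fin v → Matrix (Fin d) (Fin d) ℂ, (∀ i, ∑ a, C i a = 1) →
      ∑ a, ∑ i, W i * C i a * (W i)ᴴ = 1 := by
    intro C hC
    rw [Finset.sum_comm, ← sum_blockEmbedding_mul_conjTranspose e]
    refine Finset.sum_congr rfl fun i _ => ?_
    rw [← Matrix.sum_mul, ← Matrix.mul_sum, hC, Matrix.mul_one]
  have htr : ∀ (X : Matrix (Fin D × Fin D) (Fin D × Fin D) ℂ) (i : Fin n),
      ((W i ⊗ₖ W i) * ρ i * (W i ⊗ₖ W i)ᴴ * X).trace =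
        (ρ i * ((W i ⊗ₖ W i)ᴴ * X * (W i ⊗ₖ W i))).trace := by
    intro X i
    rw [Matrix.mul_assoc, Matrix.mul_assoc, Matrix.trace_mul_comm]
    simp only [Matrix.mul_assoc]
  refine ⟨∑ i, (w i : ℂ) • ((W i ⊗ₖ W i) * ρ i * (W i ⊗ₖ W i)ᴴ),
    fun x a => ∑ i, W i * A i x a * (W i)ᴴ, fun y b => ∑ i, W i * B i y b * (W i)ᴴ,
    ?_, ?_, ?_, ?_, ?_, ?_, ?_⟩
  · exact Matrix.posSemidef_sum _ fun i _ => ((hρ i).mul_mul_conjTranspose_same _).smul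
      (by exact_mod_cast hw.1 i)
  · have h1 : ∀ i, ((W i ⊗ₖ W i) * ρ i * (W i ⊗ₖ W i)ᴴ).trace = 1 := by
      intro i
      have := htr 1 i
      rwa [Matrix.mul_one, Matrix.mul_one, Matrix.conjTranspose_kronecker,
        ← Matrix.mul_kronecker_mul, hW, Matrix.one_kronecker_one, Matrix.mul_one, hρ1,
        ← Matrix.conjTranspose_kronecker] at this
    simp only [Matrix.trace_sum, Matrix.trace_smul, h1, smul_eq_mul, mul_one]
    exact_mod_cast hw.2
  · exact fun x a => Matrix.posSemidef_sum _ fun i _ => (hA i x a).mul_mul_conjTranspose_same _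
  · exact fun x => hsum (fun i => A i x) fun i => hA1 i x
  · exact fun y b => Matrix.posSemidef_sum _ fun i _ => (hB i y b).mul_mul_conjTranspose_same _
  · exact fun y => hsum (fun i => B i y) fun i => hB1 i y
  · intro x y a b
    rw [Finset.sum_mul, Matrix.trace_sum]
    simp only [Finset.sum_apply, Pi.smul_apply, smul_eq_mul, Complex.ofReal_sum,
      Complex.ofReal_mul]
    refine Finset.sum_congr rfl fun i _ => ?_
    rw [Matrix.smul_mul, Matrix.trace_smul, smul_eq_mul, htr, Matrix.conjTranspose_kronecker,
      ← Matrix.mul_kronecker_mul, ← Matrix.mul_kronecker_mul,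
      compress_sum_blockEmbedding e (fun i => A i x a),
      compress_sum_blockEmbedding e (fun i => B i y b), hp]

/-- The density matrices form a convex set. -/
theorem convex_densityMatrix (ι : Type*) [Fintype ι] :
    Convex ℝ {ρ : Matrix ι ι ℂ | ρ.PosSemidef ∧ ρ.trace = 1} := by
  rintro ρ ⟨hρ, hρ1⟩ σ ⟨hσ, hσ1⟩ s t hs ht hst
  refine ⟨(hρ.smul hs).add (hσ.smul ht), ?_⟩
  rw [Matrix.trace_add, Matrix.trace_smul, Matrix.trace_smul, hρ1, hσ1, ← add_smul, hst, one_smul]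

/-- Families of POVMs form a convex set. -/
theorem convex_povm (ι : Type*) [Fintype ι] [DecidableEq ι] (m v : ℕ) :
    Convex ℝ {A : Fin m → Fin v → Matrix ι ι ℂ |
      (∀ x a, (A x a).PosSemidef) ∧ ∀ x, ∑ a, A x a = 1} := by
  rintro A ⟨hA, hA1⟩ B ⟨hB, hB1⟩ s t hs ht hst
  refine ⟨fun x a => ((hA x a).smul hs).add ((hB x a).smul ht), fun x => ?_⟩
  simp only [Pi.add_apply, Pi.smul_apply, Finset.sum_add_distrib, ← Finset.smul_sum, hA1, hB1,
    ← add_smul, hst, one_smul]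

theorem Matrix.IsHermitian.ofReal_re_trace_mul {ι : Type*} [Fintype ι] {M N : Matrix ι ι ℂ}
    (hM : M.IsHermitian) (hN : N.IsHermitian) : (((M * N).trace.re : ℝ) : ℂ) = (M * N).trace := by
  refine Complex.conj_eq_iff_re.1 ?_
  rw [starRingEnd_apply, ← Matrix.trace_conjTranspose, Matrix.conjTranspose_mul, hM.eq, hN.eq,
    Matrix.trace_mul_comm]

/-- The set `Q_d` is connected: it is a continuous image of the convex set of strategies. -/
theorem isPreconnected_setOf_isQuantumBox (d m v : ℕ) :
    IsPreconnected {p | IsQuantumBox d m v p} := by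
  let F : Matrix (Fin d × Fin d) (Fin d × Fin d) ℂ × (Fin m → Fin v → Matrix (Fin d) (Fin d) ℂ) ×
      (Fin m → Fin v → Matrix (Fin d) (Fin d) ℂ) → Fin m → Fin m → Fin v → Fin v → ℝ :=
    fun q x y a b => (q.1 * (q.2.1 x a ⊗ₖ q.2.2 y b)).trace.re
  have hF : Continuous F := by
    simp only [F, Matrix.trace, Matrix.diag, Matrix.mul_apply, Matrix.kroneckerMap_apply]
    fun_prop
  have himage : {p | IsQuantumBox d m v p} = F '' (({ρ | ρ.PosSemidef ∧ ρ.trace = 1}) ×ˢ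
      ({A | (∀ x a, (A x a).PosSemidef) ∧ ∀ x, ∑ a, A x a = 1} ×ˢ
        {B | (∀ y b, (B y b).PosSemidef) ∧ ∀ y, ∑ b, B y b = 1})) := by
    ext p
    constructor
    · rintro ⟨ρ, A, B, hρ, hρ1, hA, hA1, hB, hB1, hp⟩
      refine ⟨(ρ, A, B), ⟨⟨hρ, hρ1⟩, ⟨hA, hA1⟩, hB, hB1⟩, ?_⟩
      ext x y a b
      simp [F, hp]
    · rintro ⟨⟨ρ, A, B⟩, ⟨⟨hρ, hρ1⟩, ⟨hA, hA1⟩, hB, hB1⟩, rfl⟩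
      exact ⟨ρ, A, B, hρ, hρ1, hA, hA1, hB, hB1, fun x y a b =>
        (hρ.isHermitian.ofReal_re_trace_mul ((hA x a).kronecker (hB y b)).isHermitian).symm⟩
  rw [himage]
  exact (((convex_densityMatrix _).prod ((convex_povm _ m v).prod
    (convex_povm _ m v))).isPreconnected).image F hF.continuousOn

/-- Non-signalling boxes: normalized, with the marginals of each party independent of the input
of the other party. -/
def IsNonSignalling (m v : ℕ) (p : Fin m → Fin m → Fin v → Fin v → ℝ) : Prop :=
  (∀ x x' y b, ∑ a, p x y a b = ∑ a, p x' y a b) ∧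
    (∀ x y y' a, ∑ b, p x y a b = ∑ b, p x y' a b) ∧ ∀ x y, ∑ a, ∑ b, p x y a b = 1

theorem convex_setOf_isNonSignalling (m v : ℕ) : Convex ℝ {p | IsNonSignalling m v p} := by
  rintro p ⟨hp₁, hp₂, hp₃⟩ q ⟨hq₁, hq₂, hq₃⟩ s t - - hst
  refine ⟨fun x x' y b => ?_, fun x y y' a => ?_, fun x y => ?_⟩ <;>
    simp only [Pi.add_apply, Pi.smul_apply, smul_eq_mul, Finset.sum_add_distrib, ← Finset.mul_sum]
  · rw [hp₁ x x', hq₁ x x']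
  · rw [hp₂ x y y', hq₂ x y y']
  · rw [hp₃, hq₃, mul_one, mul_one, hst]

theorem IsQuantumBox.isNonSignalling {d m v : ℕ} {p : Fin m → Fin m → Fin v → Fin v → ℝ}
    (hp : IsQuantumBox d m v p) : IsNonSignalling m v p := by
  obtain ⟨ρ, A, B, -, hρ1, -, hA1, -, hB1, hp⟩ := hp
  have hfst : ∀ x y b, ((∑ a, p x y a b : ℝ) : ℂ) = (ρ * (1 ⊗ₖ B y b)).trace := by
    intro x y b
    have : (1 : Matrix (Fin d) (Fin d) ℂ) ⊗ₖ B y b = ∑ a, A x a ⊗ₖ B y b := by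
      rw [← hA1 x]
      ext i j
      simp [Matrix.sum_apply, Finset.sum_mul]
    rw [this, Finset.mul_sum, Matrix.trace_sum, Complex.ofReal_sum]
    exact Finset.sum_congr rfl fun a _ => (hp x y a b).symm
  have hsnd : ∀ x y a, ((∑ b, p x y a b : ℝ) : ℂ) = (ρ * (A x a ⊗ₖ 1)).trace := by
    intro x y a
    have : A x a ⊗ₖ (1 : Matrix (Fin d) (Fin d) ℂ) = ∑ b, A x a ⊗ₖ B y b := by
      rw [← hB1 y]
      ext i j
      simp [Matrix.sum_apply, Finset.mul_sum]
    rw [this, Finset.mul_sum, Matrix.trace_sum, Complex.ofReal_sum]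
    exact Finset.sum_congr rfl fun b _ => (hp x y a b).symm
  refine ⟨fun x x' y b => ?_, fun x y y' a => ?_, fun x y => ?_⟩
  · exact_mod_cast (hfst x y b).trans (hfst x' y b).symm
  · exact_mod_cast (hsnd x y a).trans (hsnd x y' a).symm
  · have hsum : ∑ a, A x a ⊗ₖ (1 : Matrix (Fin d) (Fin d) ℂ) = 1 := by
      rw [← Matrix.one_kronecker_one, ← hA1 x]
      ext i j
      simp [Matrix.sum_apply, Finset.sum_mul]
    have : ((∑ a, ∑ b, p x y a b : ℝ) : ℂ) = 1 := by
      rw [Complex.ofReal_sum, Finset.sum_congr rfl fun a _ => hsnd x y a, ← Matrix.trace_sum,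
        ← Finset.mul_sum, hsum, Matrix.mul_one, hρ1]
    exact_mod_cast this

end QuantumBox

section TwoTwoTwo

/-- The eight parameters of a non-signalling (2,2,2) box: the local probabilities of the first
outcome and the joint probabilities of both first outcomes. -/
def boxParameters : (Fin 2 → Fin 2 → Fin 2 → Fin 2 → ℝ) →ₗ[ℝ]
    (Fin 2 → ℝ) × (Fin 2 → ℝ) × (Fin 2 → Fin 2 → ℝ) where
  toFun p := (fun x => ∑ b, p x 0 0 b, fun y => ∑ a, p 0 y a 0, fun x y => p x y 0 0)
  map_add' p q := by simp [Finset.sum_add_distrib, Prod.ext_iff, funext_iff]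
  map_smul' c p := by simp [mul_add, Prod.ext_iff, funext_iff]

/-- A non-signalling (2,2,2) box is determined by its eight parameters. -/
theorem injOn_boxParameters : InjOn boxParameters {p | IsNonSignalling 2 2 p} := by
  rintro p ⟨hp₁, hp₂, hp₃⟩ q ⟨hq₁, hq₂, hq₃⟩ h
  simp only [boxParameters, LinearMap.coe_mk, AddHom.coe_mk, Prod.mk.injEq, funext_iff] at h
  obtain ⟨hA, hB, hAB⟩ := h
  have key : ∀ x y, p x y 0 0 = q x y 0 0 ∧ p x y 0 1 = q x y 0 1 ∧
      p x y 1 0 = q x y 1 0 ∧ p x y 1 1 = q x y 1 1 := by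
    intro x y
    have h₁ := ((hp₂ x y 0 0).trans (hA x)).trans (hq₂ x y 0 0).symm
    have h₂ := ((hp₁ x 0 y 0).trans (hB y)).trans (hq₁ x 0 y 0).symm
    have h₃ := (hp₃ x y).trans (hq₃ x y).symm
    have h₄ := hAB x y
    simp only [Fin.sum_univ_two] at h₁ h₂ h₃
    refine ⟨h₄, ?_, ?_, ?_⟩ <;> linarith
  ext x y a b
  obtain ⟨h₁, h₂, h₃, h₄⟩ := key x y
  fin_cases a <;> fin_cases b <;> assumption

/-- A mixture of (2,2,2) boxes from `Q_d` is a mixture of eight boxes from `Q_d`. -/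
theorem exists_eight_of_mem_convexHull_isQuantumBox {d : ℕ}
    {p : Fin 2 → Fin 2 → Fin 2 → Fin 2 → ℝ}
    (hp : p ∈ convexHull ℝ {p | IsQuantumBox d 2 2 p}) :
    ∃ q : Fin 8 → Fin 2 → Fin 2 → Fin 2 → Fin 2 → ℝ, (∀ i, IsQuantumBox d 2 2 (q i)) ∧
      ∃ w ∈ stdSimplex ℝ (Fin 8), ∑ i, w i • q i = p := by
  have hrank : Module.finrank ℝ ((Fin 2 → ℝ) × (Fin 2 → ℝ) × (Fin 2 → Fin 2 → ℝ)) = 8 := by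
    simp [Module.finrank_pi_fintype]
  have hNS : ∀ S ⊆ {p | IsQuantumBox d 2 2 p}, convexHull ℝ S ⊆ {p | IsNonSignalling 2 2 p} :=
    fun S hS => convexHull_min (hS.trans fun _ h => h.isNonSignalling)
      (convex_setOf_isNonSignalling 2 2)
  have hconn := (isPreconnected_setOf_isQuantumBox d 2 2).image boxParameters
    (LinearMap.continuous_of_finiteDimensional _).continuousOn
  have hmem : boxParameters p ∈ convexHull ℝ (boxParameters '' {p | IsQuantumBox d 2 2 p}) := by
    rw [← LinearMap.image_convexHull]
    exact mem_image_of_mem _ hp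
  obtain ⟨t, ht, htc, hpt⟩ := hconn.exists_finset_card_le_finrank (by omega) hmem
  obtain ⟨g, hg⟩ := exists_fin_range_eq_finset t
    (Finset.coe_nonempty.1 (convexHull_nonempty_iff.1 ⟨_, hpt⟩)) (htc.trans_eq hrank)
  have hlift : ∀ i, ∃ q, IsQuantumBox d 2 2 q ∧ boxParameters q = g i :=
    fun i => ht (hg ▸ mem_range_self i)
  choose q hq hqg using hlift
  rw [← hg, ← funext hqg, range_comp' boxParameters, ← LinearMap.image_convexHull] at hpt
  obtain ⟨p', hp', hpp'⟩ := hpt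
  have hrange : range q ⊆ {p | IsQuantumBox d 2 2 p} := range_subset_iff.2 hq
  obtain rfl : p' = p :=
    injOn_boxParameters (hNS _ hrange hp') (hNS _ subset_rfl hp) hpp'
  exact ⟨q, hq, exists_stdSimplex_of_mem_convexHull_range hp'⟩

end TwoTwoTwo

/-- in the (2,2,2) scenario, given Masanes' theorem
(`Q_d ⊆ convexHull(Q_2)` for every `d ≥ 1`), the set `Q_16` equals the convex hull
of `Q_2`; in particular `Q_16` is convex. -/
theorem Q16_convex_of_Masanes
    (hMasanes : ∀ d : ℕ, 1 ≤ d →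
      {p : Fin 2 → Fin 2 → Fin 2 → Fin 2 → ℝ | IsQuantumBox d 2 2 p} ⊆
        convexHull ℝ
          {p : Fin 2 → Fin 2 → Fin 2 → Fin 2 → ℝ | IsQuantumBox 2 2 2 p}) :
    {p : Fin 2 → Fin 2 → Fin 2 → Fin 2 → ℝ | IsQuantumBox 16 2 2 p} =
      convexHull ℝ
        {p : Fin 2 → Fin 2 → Fin 2 → Fin 2 → ℝ | IsQuantumBox 2 2 2 p} ∧
    Convex ℝ {p : Fin 2 → Fin 2 → Fin 2 → Fin 2 → ℝ | IsQuantumBox 16 2 2 p} := by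
  have heq : {p : Fin 2 → Fin 2 → Fin 2 → Fin 2 → ℝ | IsQuantumBox 16 2 2 p} =
      convexHull ℝ {p : Fin 2 → Fin 2 → Fin 2 → Fin 2 → ℝ | IsQuantumBox 2 2 2 p} := by
    refine (hMasanes 16 (by norm_num)).antisymm fun p hp => ?_
    obtain ⟨q, hq, w, hw, rfl⟩ := exists_eight_of_mem_convexHull_isQuantumBox hp
    exact IsQuantumBox.sum_smul (D := 16) finProdFinEquiv hq hw
  exact ⟨heq, heq ▸ convex_convexHull ℝ _⟩
end
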